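/- Let C > 0 satisfy ‖fderiv ℝ w x‖ ≤ C for all x ∈ B⁴ \ {0}, let v(x) = w(x) + 2C·(x₁ + x₂ + x₃ + x₄), and define a : B⁴ \ {0} → ℝ by a(x) = Δv(x) / ‖∇v(x)‖², where Δv(x) = ∑_{α=1}^{4} ∂²v/∂x_α²(x) is the Laplacian and ∇v(x) the gradient. Then a is bounded on B⁴ \ {0}, and its gradient is in L⁴: ∫_{B⁴} ‖fderiv ℝ a x‖⁴ dx < ∞ (integral over B⁴ \ {0}). In particular a ∈ W^{1,4}(B⁴) ∩ L^∞(B⁴). -/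

import Mathlib

open MeasureTheory Metric

/-- `φ(t) = log (log (e − log t))`. -/
noncomputable def φ (t : ℝ) : ℝ := Real.log (Real.log (Real.exp 1 - Real.log t))

/-- `w(x) = ‖x‖² sin(φ(‖x‖))`; since `φ 0 = 0` this gives `w 0 = 0` as well. -/
noncomputable def w (x : EuclideanSpace ℝ (Fin 4)) : ℝ := ‖x‖ ^ 2 * Real.sin (φ ‖x‖)

/-- `v(x) = w(x) + 2C(x₁ + x₂ + x₃ + x₄)`. -/
noncomputable def v (C : ℝ) (x : EuclideanSpace ℝ (Fin 4)) : ℝ :=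
  w x + 2 * C * (x 0 + x 1 + x 2 + x 3)

/-- The Laplacian `Δg(x) = ∑_{α=1}^4 ∂²g/∂x_α²(x)`. -/
noncomputable def lap (g : EuclideanSpace ℝ (Fin 4) → ℝ) (x : EuclideanSpace ℝ (Fin 4)) : ℝ :=
  ∑ α : Fin 4,
    fderiv ℝ (fun y => fderiv ℝ g y (EuclideanSpace.single α 1)) x (EuclideanSpace.single α 1)

/-- `a(x) = Δv(x)/|∇v(x)|²`. -/
noncomputable def a (C : ℝ) (x : EuclideanSpace ℝ (Fin 4)) : ℝ :=
  lap (v C) x / ‖fderiv ℝ (v C) x‖ ^ 2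

open scoped Topology

/-- `(e − log √q)⁻¹`. -/
noncomputable def invLog (q : ℝ) : ℝ := (Real.exp 1 - Real.log q / 2)⁻¹

/-- `(log (e − log √q))⁻¹`. -/
noncomputable def invLogLog (q : ℝ) : ℝ := (Real.log (Real.exp 1 - Real.log q / 2))⁻¹

/-- `φ` as a function of `q = t²`. -/
noncomputable def phase (q : ℝ) : ℝ := Real.log (Real.log (Real.exp 1 - Real.log q / 2))

/-- The derivative of `q ↦ q sin (phase q)`. -/
noncomputable def slope₁ (q : ℝ) : ℝ :=
  Real.sin (phase q) - invLog q * invLogLog q / 2 * Real.cos (phase q)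

/-- `q ↦ q · slope₁' q = invLog q · invLogLog q · slope₂ q`. -/
noncomputable def slope₂ (q : ℝ) : ℝ :=
  -(Real.cos (phase q) / 2 +
    (invLog q + invLog q * invLogLog q) / 4 * Real.cos (phase q) +
    invLog q * invLogLog q / 4 * Real.sin (phase q))

/-- The Laplacian of `w` as a function of `q = ‖x‖²`. -/
noncomputable def radialLap (q : ℝ) : ℝ :=
  8 * slope₁ q + 4 * (invLog q * invLogLog q * slope₂ q)

/-- `q · radialLap' q = invLog q · invLogLog q · radialLapSlope q`. -/
noncomputable def radialLapSlope (q : ℝ) : ℝ :=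
  8 * slope₂ q + 2 * (invLog q + invLog q * invLogLog q) * slope₂ q -
    (invLog q * invLogLog q * Real.sin (phase q) +
      (invLog q ^ 2 + invLog q * invLogLog q * (invLog q + invLog q * invLogLog q)) / 2 *
        Real.cos (phase q) +
      (invLog q + invLog q * invLogLog q) / 2 * (invLog q * invLogLog q) * Real.sin (phase q) +
      invLog q * invLogLog q * (invLog q + invLog q * invLogLog q) / 2 * Real.sin (phase q) -
      (invLog q * invLogLog q) ^ 2 / 2 * Real.cos (phase q))

lemma exp_one_lt_sub_log {q : ℝ} (h0 : 0 < q) (h1 : q < 1) :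
    Real.exp 1 < Real.exp 1 - Real.log q / 2 := by
  linarith [Real.log_neg h0 h1]

lemma one_lt_log_sub_log {q : ℝ} (h0 : 0 < q) (h1 : q < 1) :
    1 < Real.log (Real.exp 1 - Real.log q / 2) := by
  rw [Real.lt_log_iff_exp_lt ((Real.exp_pos 1).trans (exp_one_lt_sub_log h0 h1))]
  exact exp_one_lt_sub_log h0 h1

lemma invLog_mem {q : ℝ} (h0 : 0 < q) (h1 : q < 1) : invLog q ∈ Set.Ioc 0 1 := by
  have h := exp_one_lt_sub_log h0 h1
  have he : 1 ≤ Real.exp 1 := Real.one_le_exp zero_le_one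
  exact ⟨inv_pos.2 (by linarith), inv_le_one_of_one_le₀ (by linarith)⟩

lemma invLogLog_mem {q : ℝ} (h0 : 0 < q) (h1 : q < 1) : invLogLog q ∈ Set.Ioc 0 1 := by
  have h := one_lt_log_sub_log h0 h1
  exact ⟨inv_pos.2 (by linarith), inv_le_one_of_one_le₀ h.le⟩

lemma exists_bound_of_continuous {P : ℝ × ℝ × ℝ × ℝ → ℝ} (hP : Continuous P) :
    ∃ B, 0 ≤ B ∧ ∀ q, 0 < q → q < 1 →
      |P (invLog q, invLogLog q, Real.sin (phase q), Real.cos (phase q))| ≤ B := by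
  obtain ⟨B, hB⟩ := (isCompact_Icc (a := ((-1, -1, -1, -1) : ℝ × ℝ × ℝ × ℝ))
    (b := (1, 1, 1, 1))).exists_bound_of_continuousOn hP.continuousOn
  have key : ∀ q, 0 < q → q < 1 →
      |P (invLog q, invLogLog q, Real.sin (phase q), Real.cos (phase q))| ≤ B := by
    intro q h0 h1
    have hu := invLog_mem h0 h1
    have hm := invLogLog_mem h0 h1
    refine hB _ ⟨⟨?_, ?_, ?_, ?_⟩, ⟨?_, ?_, ?_, ?_⟩⟩
    · exact (by linarith [hu.1] : (-1 : ℝ) ≤ invLog q)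
    · exact (by linarith [hm.1] : (-1 : ℝ) ≤ invLogLog q)
    · exact Real.neg_one_le_sin _
    · exact Real.neg_one_le_cos _
    · exact hu.2
    · exact hm.2
    · exact Real.sin_le_one _
    · exact Real.cos_le_one _
  exact ⟨B, (abs_nonneg _).trans (key (1 / 2) (by norm_num) (by norm_num)), key⟩

lemma exists_bound_slope₁ : ∃ B, 0 ≤ B ∧ ∀ q, 0 < q → q < 1 → |slope₁ q| ≤ B :=
  exists_bound_of_continuous (P := fun z => z.2.2.1 - z.1 * z.2.1 / 2 * z.2.2.2) (by fun_prop)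

lemma exists_bound_slope₁_deriv :
    ∃ B, 0 ≤ B ∧ ∀ q, 0 < q → q < 1 → |invLog q * invLogLog q * slope₂ q| ≤ B :=
  exists_bound_of_continuous (P := fun z => z.1 * z.2.1 * -(z.2.2.2 / 2 +
    (z.1 + z.1 * z.2.1) / 4 * z.2.2.2 + z.1 * z.2.1 / 4 * z.2.2.1)) (by fun_prop)

lemma exists_bound_radialLap : ∃ B, 0 ≤ B ∧ ∀ q, 0 < q → q < 1 → |radialLap q| ≤ B :=
  exists_bound_of_continuous (P := fun z => 8 * (z.2.2.1 - z.1 * z.2.1 / 2 * z.2.2.2) +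
    4 * (z.1 * z.2.1 * -(z.2.2.2 / 2 +
    (z.1 + z.1 * z.2.1) / 4 * z.2.2.2 + z.1 * z.2.1 / 4 * z.2.2.1))) (by fun_prop)

lemma exists_bound_radialLapSlope :
    ∃ B, 0 ≤ B ∧ ∀ q, 0 < q → q < 1 → |radialLapSlope q| ≤ B := by
  let R : ℝ × ℝ × ℝ × ℝ → ℝ := fun z => -(z.2.2.2 / 2 +
    (z.1 + z.1 * z.2.1) / 4 * z.2.2.2 + z.1 * z.2.1 / 4 * z.2.2.1)
  have hR : Continuous R := by fun_prop
  exact exists_bound_of_continuous (P := fun z =>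
    8 * R z + 2 * (z.1 + z.1 * z.2.1) * R z -
    (z.1 * z.2.1 * z.2.2.1 +
      (z.1 ^ 2 + z.1 * z.2.1 * (z.1 + z.1 * z.2.1)) / 2 * z.2.2.2 +
      (z.1 + z.1 * z.2.1) / 2 * (z.1 * z.2.1) * z.2.2.1 +
      z.1 * z.2.1 * (z.1 + z.1 * z.2.1) / 2 * z.2.2.1 -
      (z.1 * z.2.1) ^ 2 / 2 * z.2.2.2)) (by fun_prop)

lemma hasDerivAt_sub_log {q : ℝ} (h0 : 0 < q) :
    HasDerivAt (fun q => Real.exp 1 - Real.log q / 2) (-(q⁻¹ / 2)) q :=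
  ((Real.hasDerivAt_log h0.ne').div_const 2).const_sub _

lemma hasDerivAt_log_sub_log {q : ℝ} (h0 : 0 < q) (h1 : q < 1) :
    HasDerivAt (fun q => Real.log (Real.exp 1 - Real.log q / 2)) (-(invLog q / 2) / q) q := by
  convert! (hasDerivAt_sub_log h0).log
    ((Real.exp_pos 1).trans (exp_one_lt_sub_log h0 h1)).ne' using 1
  simp only [invLog, div_eq_mul_inv]
  ring

lemma hasDerivAt_invLog {q : ℝ} (h0 : 0 < q) (h1 : q < 1) :
    HasDerivAt invLog (invLog q ^ 2 / 2 / q) q := by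
  convert! (hasDerivAt_sub_log h0).fun_inv
    ((Real.exp_pos 1).trans (exp_one_lt_sub_log h0 h1)).ne' using 1
  simp only [invLog, div_eq_mul_inv, inv_pow]
  ring

lemma hasDerivAt_invLogLog {q : ℝ} (h0 : 0 < q) (h1 : q < 1) :
    HasDerivAt invLogLog (invLog q * invLogLog q ^ 2 / 2 / q) q := by
  convert! (hasDerivAt_log_sub_log h0 h1).fun_inv
    (zero_lt_one.trans (one_lt_log_sub_log h0 h1)).ne' using 1
  simp only [invLogLog, div_eq_mul_inv, inv_pow]
  ring

lemma hasDerivAt_phase {q : ℝ} (h0 : 0 < q) (h1 : q < 1) :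
    HasDerivAt phase (-(invLog q * invLogLog q / 2) / q) q := by
  convert! (hasDerivAt_log_sub_log h0 h1).log
    (zero_lt_one.trans (one_lt_log_sub_log h0 h1)).ne' using 1
  simp only [invLogLog, div_eq_mul_inv]
  ring

lemma hasDerivAt_mul_sin_phase {q : ℝ} (h0 : 0 < q) (h1 : q < 1) :
    HasDerivAt (fun q => q * Real.sin (phase q)) (slope₁ q) q := by
  convert! (hasDerivAt_id q).mul (hasDerivAt_phase h0 h1).sin using 1
  simp only [slope₁, id]
  field_simp
  ring

lemma hasDerivAt_slope₁ {q : ℝ} (h0 : 0 < q) (h1 : q < 1) :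
    HasDerivAt slope₁ (invLog q * invLogLog q * slope₂ q / q) q := by
  have hψ := hasDerivAt_phase h0 h1
  convert! hψ.sin.sub ((((hasDerivAt_invLog h0 h1).mul
    (hasDerivAt_invLogLog h0 h1)).div_const 2).mul hψ.cos) using 1
  simp only [slope₂, Pi.mul_apply]
  ring

lemma hasDerivAt_slope₂ {q : ℝ} (h0 : 0 < q) (h1 : q < 1) :
    HasDerivAt slope₂ (-(invLog q * invLogLog q * Real.sin (phase q) +
      (invLog q ^ 2 + invLog q * invLogLog q * (invLog q + invLog q * invLogLog q)) / 2 *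
        Real.cos (phase q) +
      (invLog q + invLog q * invLogLog q) / 2 * (invLog q * invLogLog q) * Real.sin (phase q) +
      invLog q * invLogLog q * (invLog q + invLog q * invLogLog q) / 2 * Real.sin (phase q) -
      (invLog q * invLogLog q) ^ 2 / 2 * Real.cos (phase q)) / 4 / q) q := by
  have hψ := hasDerivAt_phase h0 h1
  have hu := hasDerivAt_invLog h0 h1
  have hum := hu.mul (hasDerivAt_invLogLog h0 h1)
  convert! (((hψ.cos.div_const 2).add (((hu.add hum).div_const 4).mul hψ.cos)).add
    ((hum.div_const 4).mul hψ.sin)).neg using 1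
  simp only [Pi.mul_apply, Pi.add_apply]
  ring

lemma hasDerivAt_radialLap {q : ℝ} (h0 : 0 < q) (h1 : q < 1) :
    HasDerivAt radialLap (invLog q * invLogLog q * radialLapSlope q / q) q := by
  convert! ((hasDerivAt_slope₁ h0 h1).const_mul 8).add ((((hasDerivAt_invLog h0 h1).mul
    (hasDerivAt_invLogLog h0 h1)).mul (hasDerivAt_slope₂ h0 h1)).const_mul 4) using 1
  simp only [radialLapSlope, Pi.mul_apply]
  ring

local notation "E" => EuclideanSpace ℝ (Fin 4)

lemma norm_sq_mem {x : E} (hx : x ∈ ball (0 : E) 1 \ {0}) : 0 < ‖x‖ ^ 2 ∧ ‖x‖ ^ 2 < 1 := by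
  have h0 : 0 < ‖x‖ := norm_pos_iff.2 hx.2
  have h1 : ‖x‖ < 1 := mem_ball_zero_iff.1 hx.1
  exact ⟨by positivity, by nlinarith⟩

lemma punctured_ball_mem_nhds {x : E} (hx : x ∈ ball (0 : E) 1 \ {0}) :
    ball (0 : E) 1 \ {0} ∈ 𝓝 x :=
  (isOpen_ball.sdiff isClosed_singleton).mem_nhds hx

lemma w_eq : w = fun x => ‖x‖ ^ 2 * Real.sin (phase (‖x‖ ^ 2)) := by
  ext x
  simp [w, φ, phase, Real.log_pow]

lemma HasDerivAt.comp_norm_sq {f : ℝ → ℝ} {f' : ℝ} {x : E} (hf : HasDerivAt f f' (‖x‖ ^ 2)) :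
    HasFDerivAt (fun y : E => f (‖y‖ ^ 2)) ((2 * f') • innerSL ℝ x) x := by
  convert! hf.comp_hasFDerivAt x (hasStrictFDerivAt_norm_sq x).hasFDerivAt using 1
  ext y
  simp
  ring

lemma hasFDerivAt_w {x : E} (hx : x ∈ ball (0 : E) 1 \ {0}) :
    HasFDerivAt w ((2 * slope₁ (‖x‖ ^ 2)) • innerSL ℝ x) x := by
  rw [w_eq]
  exact (hasDerivAt_mul_sin_phase (norm_sq_mem hx).1 (norm_sq_mem hx).2).comp_norm_sq

/-- The gradient of `v C` on the punctured ball. -/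
noncomputable def gradV (C : ℝ) (x : E) : E :=
  (2 * slope₁ (‖x‖ ^ 2)) • x + (2 * C) • !₂[1, 1, 1, 1]

lemma hasFDerivAt_v (C : ℝ) {x : E} (hx : x ∈ ball (0 : E) 1 \ {0}) :
    HasFDerivAt (v C) (innerSL ℝ (gradV C x)) x := by
  have hlin : HasFDerivAt (fun y : E => innerSL ℝ ((2 * C) • !₂[1, 1, 1, 1] : E) y)
    (innerSL ℝ ((2 * C) • !₂[1, 1, 1, 1] : E)) x := ContinuousLinearMap.hasFDerivAt _
  convert! (hasFDerivAt_w hx).add hlin using 1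
  · ext y
    simp [v, Fin.sum_univ_four, PiLp.inner_apply]
  · simp [gradV]

lemma hasFDerivAt_gradV (C : ℝ) {x : E} (hx : x ∈ ball (0 : E) 1 \ {0}) :
    HasFDerivAt (gradV C) ((2 * slope₁ (‖x‖ ^ 2)) • ContinuousLinearMap.id ℝ E +
      ((4 * (invLog (‖x‖ ^ 2) * invLogLog (‖x‖ ^ 2) * slope₂ (‖x‖ ^ 2)) / ‖x‖ ^ 2) •
        innerSL ℝ x).smulRight x) x := by
  have h := ((hasDerivAt_slope₁ (norm_sq_mem hx).1 (norm_sq_mem hx).2).const_mul 2).comp_norm_sq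
  convert! (h.smul (hasFDerivAt_id x)).add_const ((2 * C) • !₂[1, 1, 1, 1]) using 1
  simp only [id]
  congr 3
  ring

lemma norm_gradV_ge {C : ℝ} (hC : 0 < C) {x : E} (hx : x ∈ ball (0 : E) 1 \ {0})
    (h : ‖fderiv ℝ w x‖ ≤ C) : C ≤ ‖gradV C x‖ := by
  rw [(hasFDerivAt_w hx).fderiv, ← map_smul, innerSL_apply_norm] at h
  have hone : ‖(!₂[1, 1, 1, 1] : E)‖ = 2 := by
    rw [EuclideanSpace.norm_eq, Real.sqrt_eq_iff_mul_self_eq] <;>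
      norm_num [Fin.sum_univ_four, Matrix.cons_val_two, Matrix.cons_val_three]
  have h4 : ‖((2 * C) • !₂[1, 1, 1, 1] : E)‖ = 4 * C := by
    rw [norm_smul, hone, Real.norm_of_nonneg (by positivity)]
    ring
  have := norm_sub_le (gradV C x) ((2 * slope₁ (‖x‖ ^ 2)) • x)
  rw [gradV, add_sub_cancel_left, h4, ← gradV] at this
  linarith

lemma lap_v (C : ℝ) {x : E} (hx : x ∈ ball (0 : E) 1 \ {0}) :
    lap (v C) x = radialLap (‖x‖ ^ 2) := by
  have hq := (norm_sq_mem hx).1.ne'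
  have key : ∀ e : E, fderiv ℝ (fun y => fderiv ℝ (v C) y e) x =
      fderiv ℝ (fun y => inner ℝ (gradV C y) e) x := fun e => by
    refine Filter.EventuallyEq.fderiv_eq ?_
    filter_upwards [punctured_ball_mem_nhds hx] with y hy
    rw [(hasFDerivAt_v C hy).fderiv, innerSL_apply_apply]
  have key' : ∀ e : E, fderiv ℝ (fun y => inner ℝ (gradV C y) e) x e =
      2 * slope₁ (‖x‖ ^ 2) * inner ℝ e e +
      4 * (invLog (‖x‖ ^ 2) * invLogLog (‖x‖ ^ 2) * slope₂ (‖x‖ ^ 2)) / ‖x‖ ^ 2 *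
        inner ℝ x e ^ 2 := fun e => by
    rw [((hasFDerivAt_gradV C hx).inner ℝ (hasFDerivAt_const e x)).fderiv]
    simp [inner_add_left, inner_smul_left]
    ring
  simp only [lap, key, key']
  have hn : ‖x‖ ^ 2 = x 0 ^ 2 + x 1 ^ 2 + x 2 ^ 2 + x 3 ^ 2 := by
    simp [EuclideanSpace.norm_sq_eq, Fin.sum_univ_four]
  rw [Finset.sum_add_distrib, ← Finset.mul_sum, ← Finset.mul_sum]
  have h1 : ∑ i : Fin 4, inner ℝ x (EuclideanSpace.single i (1 : ℝ)) ^ 2 = ‖x‖ ^ 2 := by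
    simp [hn, Fin.sum_univ_four, EuclideanSpace.inner_single_right]
  rw [h1, div_mul_cancel₀ _ hq, radialLap]
  simp
  ring

lemma a_eq (C : ℝ) {x : E} (hx : x ∈ ball (0 : E) 1 \ {0}) :
    a C x = radialLap (‖x‖ ^ 2) * (‖gradV C x‖ ^ 2)⁻¹ := by
  rw [a, lap_v C hx, (hasFDerivAt_v C hx).fderiv, innerSL_apply_norm, div_eq_mul_inv]

lemma exists_bound_fderiv_gradV (C : ℝ) :
    ∃ B, 0 ≤ B ∧ ∀ x ∈ ball (0 : E) 1 \ {0}, ‖fderiv ℝ (gradV C) x‖ ≤ B := by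
  obtain ⟨B₁, hB₁, h₁⟩ := exists_bound_slope₁
  obtain ⟨B₂, hB₂, h₂⟩ := exists_bound_slope₁_deriv
  refine ⟨2 * B₁ + 4 * B₂, by positivity, fun x hx => ?_⟩
  obtain ⟨hq0, hq1⟩ := norm_sq_mem hx
  rw [(hasFDerivAt_gradV C hx).fderiv]
  refine (norm_add_le _ _).trans (add_le_add ?_ ?_)
  · rw [norm_smul, norm_mul]
    calc _ ≤ ‖(2 : ℝ)‖ * ‖slope₁ (‖x‖ ^ 2)‖ * 1 := by
          gcongr; exact ContinuousLinearMap.norm_id_le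
      _ ≤ 2 * B₁ := by
          rw [mul_one, Real.norm_two]; gcongr; exact h₁ _ hq0 hq1
  · rw [ContinuousLinearMap.norm_smulRight_apply, norm_smul, innerSL_apply_norm, mul_assoc, ← sq,
      norm_div, Real.norm_of_nonneg hq0.le, div_mul_cancel₀ _ hq0.ne', norm_mul,
      Real.norm_of_nonneg (by norm_num : (0 : ℝ) ≤ 4)]
    gcongr
    exact h₂ _ hq0 hq1

lemma exists_bound_fderiv_a {C : ℝ} (hC : 0 < C)
    (hbound : ∀ x ∈ ball (0 : E) 1 \ {0}, ‖fderiv ℝ w x‖ ≤ C) :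
    ∃ A B, 0 ≤ A ∧ 0 ≤ B ∧ ∀ x ∈ ball (0 : E) 1 \ {0},
      ‖fderiv ℝ (a C) x‖ ≤ A + B * (invLog (‖x‖ ^ 2) * invLogLog (‖x‖ ^ 2) / ‖x‖) := by
  obtain ⟨B₁, hB₁, h₁⟩ := exists_bound_radialLap
  obtain ⟨B₂, hB₂, h₂⟩ := exists_bound_radialLapSlope
  obtain ⟨B₃, hB₃, h₃⟩ := exists_bound_fderiv_gradV C
  refine ⟨B₁ * (2 * B₃ / C ^ 3), 2 * B₂ / C ^ 2, by positivity, by positivity, fun x hx => ?_⟩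
  obtain ⟨hq0, hq1⟩ := norm_sq_mem hx
  have hY := norm_gradV_ge hC hx (hbound x hx)
  have hY0 : 0 < ‖gradV C x‖ := hC.trans_le hY
  have hx0 : 0 < ‖x‖ := norm_pos_iff.2 hx.2
  have hnum := (hasDerivAt_radialLap hq0 hq1).comp_norm_sq
  have hden := (hasDerivAt_inv (pow_pos hY0 2).ne').comp_hasFDerivAt x
    (hasFDerivAt_gradV C hx).differentiableAt.hasFDerivAt.norm_sq
  have ha : a C =ᶠ[𝓝 x] fun y => radialLap (‖y‖ ^ 2) * (‖gradV C y‖ ^ 2)⁻¹ := by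
    filter_upwards [punctured_ball_mem_nhds hx] with y hy using a_eq C hy
  rw [((hnum.mul hden).congr_of_eventuallyEq ha).fderiv]
  have hu := (invLog_mem hq0 hq1).1
  have hm := (invLogLog_mem hq0 hq1).1
  refine (norm_add_le _ _).trans (add_le_add ?_ ?_)
  · rw [norm_smul]
    refine mul_le_mul (h₁ _ hq0 hq1) ?_ (norm_nonneg _) hB₁
    rw [norm_smul, norm_neg, norm_inv, norm_pow, norm_pow, norm_norm]
    calc _ ≤ ((‖gradV C x‖ ^ 2) ^ 2)⁻¹ * (2 * (‖gradV C x‖ * B₃)) := by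
          gcongr
          rw [← Nat.cast_smul_eq_nsmul ℝ, norm_smul]
          norm_num
          refine (ContinuousLinearMap.opNorm_comp_le _ _).trans ?_
          rw [innerSL_apply_norm]
          gcongr
          exact h₃ x hx
      _ = 2 * B₃ / ‖gradV C x‖ ^ 3 := by field_simp
      _ ≤ 2 * B₃ / C ^ 3 := by gcongr
  · rw [norm_smul, norm_smul, innerSL_apply_norm, Function.comp_apply, norm_inv, norm_pow,
      norm_norm]
    calc _ = (‖gradV C x‖ ^ 2)⁻¹ * (2 * (invLog (‖x‖ ^ 2) * invLogLog (‖x‖ ^ 2) *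
          |radialLapSlope (‖x‖ ^ 2)|) / ‖x‖) := by
          rw [norm_mul, norm_div, norm_mul, norm_mul, Real.norm_of_nonneg hu.le,
            Real.norm_of_nonneg hm.le, Real.norm_of_nonneg hq0.le, Real.norm_two, Real.norm_eq_abs]
          field_simp
      _ ≤ (C ^ 2)⁻¹ * (2 * (invLog (‖x‖ ^ 2) * invLogLog (‖x‖ ^ 2) * B₂) / ‖x‖) := by
          gcongr
          exact h₂ _ hq0 hq1
      _ = _ := by field_simp

lemma tendsto_invLog_sq_zero :
    Filter.Tendsto (fun t => invLog (t ^ 2)) (𝓝[>] 0) (𝓝 0) := by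
  have h : Filter.Tendsto (fun t => (Real.exp 1 - Real.log t)⁻¹) (𝓝[>] 0) (𝓝 0) :=
    (Filter.tendsto_atTop_add_const_left _ _
      (Filter.tendsto_neg_atBot_atTop.comp Real.tendsto_log_nhdsGT_zero)).inv_tendsto_atTop
  simpa [invLog, Real.log_pow] using h

lemma integrableOn_invLog_sq_div :
    IntegrableOn (fun t : ℝ => invLog (t ^ 2) ^ 2 / t) (Set.Ioc 0 1) := by
  have hq : ∀ t ∈ Set.Ioo (0 : ℝ) 1, 0 < t ^ 2 ∧ t ^ 2 < 1 := fun t ht =>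
    ⟨pow_pos ht.1 2, pow_lt_one₀ ht.1.le ht.2 two_ne_zero⟩
  have hderiv : ∀ t ∈ Set.Ioo (0 : ℝ) 1,
      HasDerivAt (fun t => invLog (t ^ 2)) (invLog (t ^ 2) ^ 2 / t) t := fun t ht => by
    convert! HasDerivAt.comp (h := fun s : ℝ => s ^ 2) t
      (hasDerivAt_invLog (hq t ht).1 (hq t ht).2) (hasDerivAt_pow 2 t) using 1
    have := ht.1.ne'
    field_simp
    push_cast
    ring
  have hpos : ∀ t ∈ Set.Ioo (0 : ℝ) 1, 0 ≤ invLog (t ^ 2) ^ 2 / t := fun t ht =>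
    div_nonneg (sq_nonneg _) ht.1.le
  refine intervalIntegral.integrableOn_deriv_of_nonneg
    (g := Function.update (fun t => invLog (t ^ 2)) 0 0) ?_ (fun t ht => ?_) hpos
  · rw [continuousOn_update_iff]
    refine ⟨fun t ht => ?_, fun _ => tendsto_invLog_sq_zero.mono_left
      (nhdsWithin_mono _ fun t ht => lt_of_le_of_ne ht.1.1 (Ne.symm ht.2))⟩
    have ht0 : t ≠ 0 := ht.2
    have htp : 0 < t := lt_of_le_of_ne ht.1.1 (Ne.symm ht.2)
    have hd : Real.exp 1 - Real.log (t ^ 2) / 2 ≠ 0 := by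
      have := Real.log_nonpos (sq_nonneg t) (pow_le_one₀ ht.1.1 ht.1.2)
      have := Real.exp_pos 1
      linarith
    unfold invLog
    exact ContinuousAt.continuousWithinAt (by fun_prop (disch := first | assumption | positivity))
  · refine (hderiv t ht).congr_of_eventuallyEq ?_
    filter_upwards [lt_mem_nhds ht.1] with s hs
    exact Function.update_of_ne hs.ne' _ _

lemma integrableOn_invLog_sq_div_norm_pow :
    IntegrableOn (fun x : E => invLog (‖x‖ ^ 2) ^ 2 / ‖x‖ ^ 4) (ball 0 1) := by
  rw [integrableOn_fun_norm_addHaar volume (f := fun t => invLog (t ^ 2) ^ 2 / t ^ 4)]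
  refine (integrableOn_invLog_sq_div.mono_set Set.Ioo_subset_Ioc_self).congr_fun (fun t ht => ?_)
    measurableSet_Ioo
  have := ht.1.ne'
  simp only [finrank_euclideanSpace_fin, smul_eq_mul]
  field_simp
  norm_num
  field_simp

/-- If `C > 0` bounds `‖Dw‖` on the punctured unit ball, then `a = Δv |∇v|⁻²` is bounded
on the punctured unit ball and `‖∇a‖ ∈ L⁴` there: `a ∈ W^{1,4}(B⁴) ∩ L^∞(B⁴)`. -/
theorem stmt_16 (C : ℝ) (hC : 0 < C)
    (hbound : ∀ x ∈ ball (0 : EuclideanSpace ℝ (Fin 4)) 1 \ {0}, ‖fderiv ℝ w x‖ ≤ C) :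
    (∃ C' : ℝ, ∀ x ∈ ball (0 : EuclideanSpace ℝ (Fin 4)) 1 \ {0}, |a C x| ≤ C') ∧
    IntegrableOn (fun x => ‖fderiv ℝ (a C) x‖ ^ 4)
      (ball (0 : EuclideanSpace ℝ (Fin 4)) 1 \ {0}) volume := by
  constructor
  · obtain ⟨B, hB, h⟩ := exists_bound_radialLap
    refine ⟨B * (C ^ 2)⁻¹, fun x hx => ?_⟩
    have hY := norm_gradV_ge hC hx (hbound x hx)
    rw [a_eq C hx, abs_mul, abs_inv, abs_pow, abs_norm]
    gcongr
    exact h _ (norm_sq_mem hx).1 (norm_sq_mem hx).2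
  · obtain ⟨A, B, hA, hB, h⟩ := exists_bound_fderiv_a hC hbound
    have hint : IntegrableOn (fun x : E => 8 * (A ^ 4 + B ^ 4 * (invLog (‖x‖ ^ 2) ^ 2 / ‖x‖ ^ 4)))
        (ball 0 1 \ {0}) :=
      IntegrableOn.mono_set (((integrableOn_const measure_ball_lt_top.ne).add
        (integrableOn_invLog_sq_div_norm_pow.const_mul _)).const_mul _) Set.sdiff_subset
    refine hint.mono' ((measurable_fderiv ℝ (a C)).norm.pow_const 4).aestronglyMeasurable ?_
    filter_upwards [ae_restrict_mem (measurableSet_ball.diff (measurableSet_singleton 0))] with x hx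
    obtain ⟨hq0, hq1⟩ := norm_sq_mem hx
    obtain ⟨hu0, hu1⟩ := invLog_mem hq0 hq1
    obtain ⟨hm0, hm1⟩ := invLogLog_mem hq0 hq1
    rw [norm_pow, norm_norm]
    calc _ ≤ (A + B * (invLog (‖x‖ ^ 2) * invLogLog (‖x‖ ^ 2) / ‖x‖)) ^ 4 := by
          gcongr
          exact h x hx
      _ ≤ 2 ^ (4 - 1) * (A ^ 4 + (B * (invLog (‖x‖ ^ 2) * invLogLog (‖x‖ ^ 2) / ‖x‖)) ^ 4) :=
          add_pow_le hA (by positivity) 4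
      _ = 8 * (A ^ 4 + B ^ 4 * ((invLog (‖x‖ ^ 2) * invLogLog (‖x‖ ^ 2)) ^ 4 / ‖x‖ ^ 4)) := by
          rw [mul_pow, div_pow]
          norm_num
      _ ≤ 8 * (A ^ 4 + B ^ 4 * (invLog (‖x‖ ^ 2) ^ 2 / ‖x‖ ^ 4)) := by
          gcongr
          calc _ ≤ (invLog (‖x‖ ^ 2) * 1) ^ 4 := by gcongr
            _ ≤ _ := by
              rw [mul_one]
              exact pow_le_pow_of_le_one hu0.le hu1 (by norm_num)
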